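/- For all positive integers m and n, every tree T on n vertices contains a vertex set W with |W| ≤ 4n/m such that every connected component of T \ W has at most m vertices. -/

import Mathlib

theorem aux_leaf {V : Type*} (G : SimpleGraph V) (hT : G.IsTree)
    (S : Finset V) (hS : S.Nonempty) :
    ∃ l ∈ S, ∃ q, ∀ u ∈ S, G.Adj l u → u = q := by
  obtain ⟨r, hr⟩ := hS
  obtain ⟨l, hl, hmax⟩ := S.exists_max_image (fun v => G.dist r v) ⟨r, hr⟩
  obtain ⟨p, hp, hp'⟩ := (hT.connected r l).exists_path_of_dist
  refine ⟨l, hl, p.penultimate, fun u hu hadj => ?_⟩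
  obtain ⟨q, hq, hq'⟩ := (hT.connected r u).exists_path_of_dist
  have h1 := hT.dist_eq_dist_add_one_of_adj r hadj
  have h2 := hmax u hu
  have h3 : G.dist r l = G.dist r u + 1 := by
    omega
  have h4 : (q.concat hadj.symm).IsPath := by
    apply SimpleGraph.Walk.isPath_of_length_eq_dist
    rw [SimpleGraph.Walk.length_concat, hq', h3]
  have h5 : p = q.concat hadj.symm := (hT.existsUnique_path r l).unique hp h4
  rw [h5, SimpleGraph.Walk.penultimate_concat]

open Classical in
theorem aux_main {V : Type*} (G : SimpleGraph V) (hT : G.IsTree) (m : ℕ) :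
    ∀ (k : ℕ) (S : Finset V), S.card = k → ∀ w : V → ℕ,
      ∃ (W : Finset V) (t : V → V), W ⊆ S ∧ m * W.card ≤ ∑ v ∈ S, w v ∧
        (∀ v ∈ S, t v ∈ S) ∧
        (∀ u ∈ S, ∀ v ∈ S, u ∉ W → v ∉ W → G.Adj u v → t u = t v) ∧
        ∀ x, ∑ v ∈ S, (if v ∉ W ∧ t v = x then w v else 0) ≤ m := by
  intro k
  induction k with
  | zero =>
    intro S hS w
    rw [Finset.card_eq_zero] at hS
    subst hS
    exact ⟨∅, id, by simp⟩
  | succ k ih =>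
    intro S hS w
    obtain ⟨l, hl, q, hq⟩ := aux_leaf G hT S (Finset.card_pos.mp (by omega))
    obtain ⟨S', hlS, rfl⟩ : ∃ S', l ∉ S' ∧ S = insert l S' :=
      ⟨S.erase l, by simp, (Finset.insert_erase hl).symm⟩
    have hk : S'.card = k := by
      rw [Finset.card_insert_of_notMem hlS] at hS
      omega
    have hqS : ∀ u ∈ S', G.Adj l u → u = q := fun u hu => hq u (Finset.mem_insert_of_mem hu)
    have hne : ∀ v ∈ S', v ≠ l := fun v hv h => hlS (h ▸ hv)
    by_cases hw : m < w l
    · obtain ⟨W, t, hWS, hc, ht, had, hs⟩ := ih S' hk w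
      have hlW : l ∉ W := fun h => hlS (hWS h)
      refine ⟨insert l W, Function.update t l l, Finset.insert_subset_insert _ hWS, ?_, ?_, ?_, ?_⟩
      · rw [Finset.card_insert_of_notMem hlW, Finset.sum_insert hlS]
        linarith
      · grind
      · grind
      · intro x
        rw [Finset.sum_insert hlS]
        simp only [Finset.mem_insert_self, not_true_eq_false, false_and, if_false, zero_add]
        refine le_trans (le_of_eq (Finset.sum_congr rfl fun v hv => ?_)) (hs x)
        have := hne v hv
        simp [this]
    · push Not at hw
      by_cases hqm : q ∈ S'
      · obtain ⟨W, t, hWS, hc, ht, had, hs⟩ := ih S' hk (fun v => w v + if v = q then w l else 0)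
        have hlW : l ∉ W := fun h => hlS (hWS h)
        have key : ∀ x, ∑ v ∈ S', (if v ∉ W ∧ t v = x then
            (w v + if v = q then w l else 0) else 0) =
            ∑ v ∈ S', (if v ∉ W ∧ t v = x then w v else 0) +
              if q ∉ W ∧ t q = x then w l else 0 := by
          intro x
          rw [← Finset.sum_ite_eq_of_mem' S' q
            (fun v => if v ∉ W ∧ t v = x then w l else 0) hqm, ← Finset.sum_add_distrib]
          refine Finset.sum_congr rfl fun v hv => ?_
          split_ifs <;> simp
        refine ⟨W, Function.update t l (if q ∈ W then l else t q),
          hWS.trans (Finset.subset_insert _ _), ?_, ?_, ?_, ?_⟩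
        · rw [Finset.sum_add_distrib, Finset.sum_ite_eq_of_mem' S' q _ hqm] at hc
          rw [Finset.sum_insert hlS]
          linarith
        · grind
        · have := fun u v => G.adj_comm u v
          grind
        · intro x
          rw [Finset.sum_insert hlS]
          have h1 := hs x
          rw [key] at h1
          have h2 : ∑ v ∈ S', (if v ∉ W ∧ Function.update t l (if q ∈ W then l else t q) v = x
              then w v else 0) = ∑ v ∈ S', (if v ∉ W ∧ t v = x then w v else 0) := by
            refine Finset.sum_congr rfl fun v hv => ?_
            simp [hne v hv]
          rw [h2]
          by_cases hqW : q ∈ W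
          · simp only [hqW, if_true, Function.update_self]
            by_cases hx : l = x
            · have : ∑ v ∈ S', (if v ∉ W ∧ t v = x then w v else 0) = 0 :=
                Finset.sum_eq_zero fun v hv => by
                  have := ht v hv
                  grind
              rw [this]
              split_ifs <;> omega
            · simp [hx]
              grind
          · simp only [hqW, if_false, Function.update_self, hlW]
            simp only [hqW] at h1
            omega
      · obtain ⟨W, t, hWS, hc, ht, had, hs⟩ := ih S' hk w
        have hlW : l ∉ W := fun h => hlS (hWS h)
        refine ⟨W, Function.update t l l, hWS.trans (Finset.subset_insert _ _), ?_, ?_, ?_, ?_⟩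
        · rw [Finset.sum_insert hlS]
          omega
        · grind
        · have := fun u v => G.adj_comm u v
          grind
        · intro x
          rw [Finset.sum_insert hlS]
          have h1 := hs x
          have h2 : ∑ v ∈ S', (if v ∉ W ∧ Function.update t l l v = x
              then w v else 0) = ∑ v ∈ S', (if v ∉ W ∧ t v = x then w v else 0) := by
            refine Finset.sum_congr rfl fun v hv => ?_
            simp [hne v hv]
          rw [h2]
          simp only [Function.update_self]
          by_cases hx : l = x
          · have : ∑ v ∈ S', (if v ∉ W ∧ t v = x then w v else 0) = 0 :=
              Finset.sum_eq_zero fun v hv => by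
                have := ht v hv
                grind
            rw [this]
            split_ifs <;> omega
          · simp [hx]
            grind

theorem stmt_3 {V : Type*} [Fintype V] (G : SimpleGraph V) (hT : G.IsTree)
    (m : ℕ) (hm : 0 < m) :
    ∃ W : Finset V, m * W.card ≤ 4 * Fintype.card V ∧
      ∀ c : (G.induce {u : V | u ∉ W}).ConnectedComponent, c.supp.ncard ≤ m := by
  classical
  obtain ⟨W, t, -, hc, -, had, hs⟩ := aux_main G hT m _ Finset.univ rfl (fun _ => 1)
  refine ⟨W, ?_, ?_⟩
  · simp at hc
    omega
  · intro c
    have hreach : ∀ a b : {u : V | u ∉ W}, (G.induce {u : V | u ∉ W}).Reachable a b →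
        t a = t b := by
      rintro a b ⟨p⟩
      induction p with
      | nil => rfl
      | @cons u v _ h _ ih =>
        rw [← ih]
        exact had _ (Finset.mem_univ _) _ (Finset.mem_univ _) u.2 v.2 h
    induction c using SimpleGraph.ConnectedComponent.ind with
    | h a =>
      have h1 := hs (t a)
      rw [← Finset.sum_filter, ← Finset.card_eq_sum_ones] at h1
      refine le_trans ?_ h1
      rw [← Set.ncard_coe_finset, ← Set.ncard_image_of_injective _ Subtype.val_injective]
      refine Set.ncard_le_ncard ?_ (Finset.finite_toSet _)
      rintro _ ⟨b, hb, rfl⟩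
      have hb' := SimpleGraph.ConnectedComponent.exact hb
      simp only [Finset.coe_filter, Finset.mem_univ, true_and, Set.mem_setOf_eq]
      exact ⟨b.2, hreach _ _ hb'⟩
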